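/- Let C be a positive prevariety of languages over a finite alphabet A and let α : A* → M be a monoid morphism into a finite monoid. Then: (i) for every ordered C-morphism η : A* → (N, ≤) and every C-pair (s,t) for α, there exist words u, v with η(u) ≤ η(v), α(u) = s and α(v) = t; (ii) there exists an ordered C-morphism η : A* → (N, ≤) such that for all words u, v, if η(u) ≤ η(v) then (α(u), α(v)) is a C-pair for α. -/

import Mathlib

/- Common definitions: languages over a finite alphabet, classes of languages,
prevarieties, polynomial closure and its variants, separation, C-pairs, etc. -/

namespace RegLang

variable {A : Type}

/-- A language over the alphabet `A`: a set of finite words. -/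
abbrev Lang (A : Type) := Set (FreeMonoid A)

/-- A class of languages over the alphabet `A`. -/
abbrev LangClass (A : Type) := Set (Lang A)

/-- A lattice of languages: contains `∅` and `A*` and is closed under binary
union and intersection. -/
def IsLatticeClass (C : LangClass A) : Prop :=
  ∅ ∈ C ∧ (Set.univ : Lang A) ∈ C ∧
    (∀ K L : Lang A, K ∈ C → L ∈ C → K ∪ L ∈ C) ∧
    (∀ K L : Lang A, K ∈ C → L ∈ C → K ∩ L ∈ C)

/-- A Boolean algebra of languages: a lattice of languages closed under complement. -/
def IsBooleanAlgebraClass (C : LangClass A) : Prop :=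
  IsLatticeClass C ∧ ∀ L ∈ C, Lᶜ ∈ C

/-- A class is quotient-closed if it is closed under left and right quotients by words. -/
def QuotientClosed (C : LangClass A) : Prop :=
  ∀ L ∈ C, ∀ u : FreeMonoid A,
    {w : FreeMonoid A | u * w ∈ L} ∈ C ∧ {w : FreeMonoid A | w * u ∈ L} ∈ C

/-- A language is regular if it is a preimage of a subset under a monoid morphism
into a finite monoid. -/
def IsRegularLang (L : Lang A) : Prop :=
  ∃ (M : Type) (_ : Monoid M) (_ : Finite M) (φ : FreeMonoid A →* M) (F : Set M),
    L = φ ⁻¹' F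

/-- A positive prevariety: a quotient-closed lattice of regular languages. -/
def IsPositivePrevariety (C : LangClass A) : Prop :=
  IsLatticeClass C ∧ QuotientClosed C ∧ ∀ L ∈ C, IsRegularLang L

/-- A prevariety: a quotient-closed Boolean algebra of regular languages. -/
def IsPrevariety (C : LangClass A) : Prop :=
  IsBooleanAlgebraClass C ∧ QuotientClosed C ∧ ∀ L ∈ C, IsRegularLang L

/-- The marked concatenation `KaL = {uav : u ∈ K, v ∈ L}`. -/
def MarkedCat (K : Lang A) (a : A) (L : Lang A) : Lang A :=
  {w | ∃ u ∈ K, ∃ v ∈ L, w = u * FreeMonoid.of a * v}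

/-- A marked concatenation `KaL` is unambiguous if every word of `KaL` has a
unique factorization `uav` with `u ∈ K` and `v ∈ L`. -/
def Unambiguous (K : Lang A) (a : A) (L : Lang A) : Prop :=
  ∀ u u' v v' : FreeMonoid A, u ∈ K → u' ∈ K → v ∈ L → v' ∈ L →
    u * FreeMonoid.of a * v = u' * FreeMonoid.of a * v' → u = u' ∧ v = v'

/-- The marked concatenation `KaL` is left deterministic: `K ∩ KaA* = ∅`. -/
def LeftDeterministic (K : Lang A) (a : A) (_L : Lang A) : Prop :=
  K ∩ MarkedCat K a Set.univ = ∅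

/-- The marked concatenation `KaL` is right deterministic: `L ∩ A*aL = ∅`. -/
def RightDeterministic (_K : Lang A) (a : A) (L : Lang A) : Prop :=
  L ∩ MarkedCat Set.univ a L = ∅

/-- Polynomial closure: the least class containing `C` and closed under binary
union and marked concatenation. -/
inductive Pol (C : LangClass A) : Lang A → Prop
  | base {L : Lang A} : L ∈ C → Pol C L
  | union {K L : Lang A} : Pol C K → Pol C L → Pol C (K ∪ L)
  | mcat {K L : Lang A} (a : A) : Pol C K → Pol C L → Pol C (MarkedCat K a L)

/-- `coPol C`: the class of complements of languages in `Pol C`. -/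
def coPol (C : LangClass A) : LangClass A := {L | ∃ K : Lang A, Pol C K ∧ L = Kᶜ}

/-- `BPol C`: the least Boolean algebra of languages containing `Pol C`. -/
inductive BPol (C : LangClass A) : Lang A → Prop
  | base {L : Lang A} : Pol C L → BPol C L
  | empty : BPol C ∅
  | univ : BPol C Set.univ
  | union {K L : Lang A} : BPol C K → BPol C L → BPol C (K ∪ L)
  | inter {K L : Lang A} : BPol C K → BPol C L → BPol C (K ∩ L)
  | compl {L : Lang A} : BPol C L → BPol C Lᶜ

/-- Unambiguous polynomial closure: the least class containing `C` and closed
under disjoint union and unambiguous marked concatenation. -/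
inductive UPol (C : LangClass A) : Lang A → Prop
  | base {L : Lang A} : L ∈ C → UPol C L
  | disjUnion {K L : Lang A} : UPol C K → UPol C L → K ∩ L = ∅ → UPol C (K ∪ L)
  | mcat {K L : Lang A} (a : A) : UPol C K → UPol C L → Unambiguous K a L →
      UPol C (MarkedCat K a L)

/-- Alternated polynomial closure: the least class containing `C` and closed under
disjoint union and left- and right-deterministic marked concatenation. -/
inductive APol (C : LangClass A) : Lang A → Prop
  | base {L : Lang A} : L ∈ C → APol C L
  | disjUnion {K L : Lang A} : APol C K → APol C L → K ∩ L = ∅ → APol C (K ∪ L)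
  | leftCat {K L : Lang A} (a : A) : APol C K → APol C L → LeftDeterministic K a L →
      APol C (MarkedCat K a L)
  | rightCat {K L : Lang A} (a : A) : APol C K → APol C L → RightDeterministic K a L →
      APol C (MarkedCat K a L)

/-- `KaL` is left `C`-deterministic: there are `K', L' ∈ C` with `K ⊆ K'`, `L ⊆ L'`
and `K'aL'` left deterministic. -/
def LeftCDeterministic (C : LangClass A) (K : Lang A) (a : A) (L : Lang A) : Prop :=
  ∃ K' ∈ C, ∃ L' ∈ C, K ⊆ K' ∧ L ⊆ L' ∧ LeftDeterministic K' a L'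

/-- `KaL` is right `C`-deterministic: there are `K', L' ∈ C` with `K ⊆ K'`, `L ⊆ L'`
and `K'aL'` right deterministic. -/
def RightCDeterministic (C : LangClass A) (K : Lang A) (a : A) (L : Lang A) : Prop :=
  ∃ K' ∈ C, ∃ L' ∈ C, K ⊆ K' ∧ L ⊆ L' ∧ RightDeterministic K' a L'

/-- Weak alternated polynomial closure: the least class containing `C` and closed under
disjoint union and left- and right-`C`-deterministic marked concatenation. -/
inductive WAPol (C : LangClass A) : Lang A → Prop
  | base {L : Lang A} : L ∈ C → WAPol C L
  | disjUnion {K L : Lang A} : WAPol C K → WAPol C L → K ∩ L = ∅ → WAPol C (K ∪ L)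
  | leftCat {K L : Lang A} (a : A) : WAPol C K → WAPol C L →
      LeftCDeterministic C K a L → WAPol C (MarkedCat K a L)
  | rightCat {K L : Lang A} (a : A) : WAPol C K → WAPol C L →
      RightCDeterministic C K a L → WAPol C (MarkedCat K a L)

/-- `K` separates `L₁` from `L₂`. -/
def Separates (K L₁ L₂ : Lang A) : Prop := L₁ ⊆ K ∧ K ∩ L₂ = ∅

/-- `L₁` is `C`-separable from `L₂`. -/
def Separable (C : LangClass A) (L₁ L₂ : Lang A) : Prop := ∃ K ∈ C, Separates K L₁ L₂

/-- `(s, t)` is a `C`-pair for `φ`: `φ⁻¹(s)` is not `C`-separable from `φ⁻¹(t)`. -/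
def CPair (C : LangClass A) {M : Type} [Monoid M] (φ : FreeMonoid A →* M)
    (s t : M) : Prop :=
  ¬ Separable C (φ ⁻¹' {s}) (φ ⁻¹' {t})

/-- The canonical `C`-preorder on `M` associated with `φ`. -/
def CPreorder (C : LangClass A) {M : Type} [Monoid M] (φ : FreeMonoid A →* M)
    (s t : M) : Prop :=
  ∀ F : Set M, φ ⁻¹' F ∈ C → s ∈ F → t ∈ F

/-- The canonical `C`-equivalence on `M` associated with `φ`. -/
def CEquiv (C : LangClass A) {M : Type} [Monoid M] (φ : FreeMonoid A →* M)
    (s t : M) : Prop :=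
  ∀ F : Set M, φ ⁻¹' F ∈ C → (s ∈ F ↔ t ∈ F)

/-- A `C`-morphism: a surjective morphism all of whose recognized languages are in `C`. -/
def IsCMorphism (C : LangClass A) {N : Type} [Monoid N] (η : FreeMonoid A →* N) : Prop :=
  Function.Surjective η ∧ ∀ F : Set N, η ⁻¹' F ∈ C

/-- `e` is the idempotent power `s^ω` of `s`: an idempotent of the form `s^n`, `n ≥ 1`
(in a finite monoid such an element exists and is unique). -/
def IsIdempotentPower {M : Type} [Monoid M] (s e : M) : Prop :=
  IsIdempotentElem e ∧ ∃ n : ℕ, 1 ≤ n ∧ e = s ^ n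

/-- The `C`-kernel of `φ`: the elements `s` such that `{ε}` is not `C`-separable
from `φ⁻¹(s)`. -/
def gKernel (C : LangClass A) {M : Type} [Monoid M] (φ : FreeMonoid A →* M) : Set M :=
  {s | ¬ Separable C ({1} : Lang A) (φ ⁻¹' {s})}

/-- The strict `C`-kernel of `φ`: the intersection of the `C`-kernel with `φ(A⁺)`. -/
def strictGKernel (C : LangClass A) {M : Type} [Monoid M]
    (φ : FreeMonoid A →* M) : Set M :=
  gKernel C φ ∩ φ '' {w : FreeMonoid A | w ≠ 1}

/-- A group language: one recognized by a morphism into a finite group. -/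
def IsGroupLanguage (L : Lang A) : Prop :=
  ∃ (G : Type) (_ : Group G) (_ : Finite G) (φ : FreeMonoid A →* G) (F : Set G),
    L = φ ⁻¹' F

/-- A prevariety of group languages. -/
def IsGroupPrevariety (G : LangClass A) : Prop :=
  IsPrevariety G ∧ ∀ L ∈ G, IsGroupLanguage L

/-- The well-suited extension `G⁺`: all languages `L ∩ A⁺` and `L ∪ {ε}` for `L ∈ G`. -/
def wellSuited (G : LangClass A) : LangClass A :=
  {L | ∃ K ∈ G, L = K ∩ {w : FreeMonoid A | w ≠ 1} ∨ L = K ∪ ({1} : Lang A)}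

/-- `le` is a partial order on the monoid `N` compatible with multiplication. -/
def IsCompatiblePartialOrder {N : Type} [Monoid N] (le : N → N → Prop) : Prop :=
  (∀ x, le x x) ∧ (∀ x y z, le x y → le y z → le x z) ∧
    (∀ x y, le x y → le y x → x = y) ∧
    (∀ x x' y y', le x y → le x' y' → le (x * x') (y * y'))

/-- `F` is upward closed for the relation `le`. -/
def UpClosed {N : Type} (le : N → N → Prop) (F : Set N) : Prop :=
  ∀ s ∈ F, ∀ t, le s t → t ∈ F

/-- An ordered `C`-morphism: a surjective morphism onto a finite ordered monoid such
that preimages of upward closed sets are in `C`. -/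
def IsOrderedCMorphism (C : LangClass A) {N : Type} [Monoid N]
    (η : FreeMonoid A →* N) (le : N → N → Prop) : Prop :=
  Function.Surjective η ∧ IsCompatiblePartialOrder le ∧
    ∀ F : Set N, UpClosed le F → η ⁻¹' F ∈ C

/-- The syntactic preorder of `L`: `u ≼_L v` iff `xuy ∈ L → xvy ∈ L` for all `x, y`. -/
def SynPre (L : Lang A) (u v : FreeMonoid A) : Prop :=
  ∀ x y : FreeMonoid A, x * u * y ∈ L → x * v * y ∈ L

/-- `φ` is (a copy of) the syntactic morphism of `L`: it is surjective and identifies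
exactly the words that are syntactically congruent for `L`. -/
def IsSyntacticMorphism (L : Lang A) {M : Type} [Monoid M]
    (φ : FreeMonoid A →* M) : Prop :=
  Function.Surjective φ ∧
    ∀ u v : FreeMonoid A, φ u = φ v ↔ ∀ x y : FreeMonoid A, (x * u * y ∈ L ↔ x * v * y ∈ L)

/-- `le` is (a copy of) the syntactic order of `L` on the target of `φ`. -/
def IsSyntacticOrder (L : Lang A) {M : Type} [Monoid M] (φ : FreeMonoid A →* M)
    (le : M → M → Prop) : Prop :=
  ∀ u v : FreeMonoid A, le (φ u) (φ v) ↔ SynPre L u v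

theorem IsLatticeClass.biUnion_mem {C : LangClass A} (hC : IsLatticeClass C) {ι : Type}
    {S : Set ι} (hS : S.Finite) (f : ι → Lang A) (hf : ∀ i ∈ S, f i ∈ C) :
    (⋃ i ∈ S, f i) ∈ C := by
  induction S, hS using Set.Finite.induction_on with
  | empty => simpa using hC.1
  | insert _ _ ih =>
    rw [Set.biUnion_insert]
    exact hC.2.2.1 _ _ (hf _ (Set.mem_insert _ _))
      (ih fun i hi => hf i (Set.mem_insert_of_mem _ hi))

theorem IsLatticeClass.sInter_mem {C : LangClass A} (hC : IsLatticeClass C)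
    {S : Set (Lang A)} (hS : S.Finite) (hSC : S ⊆ C) : ⋂₀ S ∈ C := by
  induction S, hS using Set.Finite.induction_on with
  | empty => simpa using hC.2.1
  | insert _ _ ih =>
    rw [Set.sInter_insert]
    exact hC.2.2.2 _ _ (hSC (Set.mem_insert _ _))
      (ih fun i hi => hSC (Set.mem_insert_of_mem _ hi))

/-- The set of all two-sided quotients `x⁻¹Ly⁻¹` of a language `L`. -/
def twoSidedQuotients (L : Lang A) : Set (Lang A) :=
  Set.range fun p : FreeMonoid A × FreeMonoid A => {w | p.1 * w * p.2 ∈ L}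

theorem self_mem_twoSidedQuotients (L : Lang A) : L ∈ twoSidedQuotients L :=
  ⟨(1, 1), by simp⟩

theorem quotientClosed_twoSidedQuotients (L : Lang A) :
    QuotientClosed (twoSidedQuotients L) := by
  rintro _ ⟨⟨x, y⟩, rfl⟩ u
  exact ⟨⟨(x * u, y), by simp [mul_assoc]⟩, ⟨(x, u * y), by simp [mul_assoc]⟩⟩

theorem twoSidedQuotients_subset {C : LangClass A} (hC : QuotientClosed C) {L : Lang A}
    (hL : L ∈ C) : twoSidedQuotients L ⊆ C := by
  rintro _ ⟨⟨x, y⟩, rfl⟩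
  exact (hC _ (hC L hL y).2 x).1

theorem IsRegularLang.finite_twoSidedQuotients {L : Lang A} (hL : IsRegularLang L) :
    (twoSidedQuotients L).Finite := by
  obtain ⟨M, _, _, φ, F, rfl⟩ := hL
  refine (Set.finite_range fun p : M × M => {w : FreeMonoid A | p.1 * φ w * p.2 ∈ F}).subset ?_
  rintro _ ⟨⟨x, y⟩, rfl⟩
  exact ⟨(φ x, φ y), by simp⟩

/-- The preorder on words induced by a class `Q`: `v` lies in every member of `Q`
containing `u`. -/
def ClassPre (Q : LangClass A) (u v : FreeMonoid A) : Prop :=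
  ∀ L ∈ Q, u ∈ L → v ∈ L

theorem ClassPre.trans {Q : LangClass A} {u v w : FreeMonoid A} (h : ClassPre Q u v)
    (h' : ClassPre Q v w) : ClassPre Q u w :=
  fun L hL hu => h' L hL (h L hL hu)

theorem ClassPre.mul {Q : LangClass A} (hQ : QuotientClosed Q) {u v u' v' : FreeMonoid A}
    (h : ClassPre Q u v) (h' : ClassPre Q u' v') : ClassPre Q (u * u') (v * v') :=
  fun L hL hu => h' _ (hQ L hL v).1 (h _ (hQ L hL u').2 hu)

/-- The congruence on words associated with the preorder `ClassPre Q`. -/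
def classCon (Q : LangClass A) (hQ : QuotientClosed Q) : Con (FreeMonoid A) where
  r u v := ClassPre Q u v ∧ ClassPre Q v u
  iseqv :=
    { refl := fun _ => ⟨fun _ _ h => h, fun _ _ h => h⟩
      symm := fun h => ⟨h.2, h.1⟩
      trans := fun h h' => ⟨h.1.trans h'.1, h'.2.trans h.2⟩ }
  mul' h h' := ⟨h.1.mul hQ h'.1, h.2.mul hQ h'.2⟩

theorem finite_quotient_classCon {Q : LangClass A} (hQ : QuotientClosed Q) (hfin : Q.Finite) :
    Finite (classCon Q hQ).Quotient := by
  have : Finite Q := hfin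
  refine Finite.of_injective
    (fun n : (classCon Q hQ).Quotient => {L : Q | Quotient.out n ∈ L.1}) fun n m h => ?_
  rw [← Quotient.out_eq n, ← Quotient.out_eq m]
  refine Quotient.sound ⟨fun L hL hu => ?_, fun L hL hu => ?_⟩
  · exact (Set.ext_iff.1 h ⟨L, hL⟩).1 hu
  · exact (Set.ext_iff.1 h ⟨L, hL⟩).2 hu

theorem exists_isOrderedCMorphism_of_finite {C Q : LangClass A} (hC : IsLatticeClass C)
    (hQC : Q ⊆ C) (hfin : Q.Finite) (hQ : QuotientClosed Q) :
    ∃ (N : Type) (_ : Monoid N) (_ : Finite N) (η : FreeMonoid A →* N) (le : N → N → Prop),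
      IsOrderedCMorphism C η le ∧ ∀ u v, le (η u) (η v) ↔ ClassPre Q u v := by
  have hN := finite_quotient_classCon hQ hfin
  let η : FreeMonoid A →* (classCon Q hQ).Quotient := (classCon Q hQ).mk'
  have hη : Function.Surjective η := Con.mk'_surjective
  have hη_eq : ∀ u v, η u = η v ↔ ClassPre Q u v ∧ ClassPre Q v u :=
    fun u v => (classCon Q hQ).eq
  let le : (classCon Q hQ).Quotient → (classCon Q hQ).Quotient → Prop :=
    fun n m => ∃ u v, η u = n ∧ η v = m ∧ ClassPre Q u v
  have hle : ∀ u v, le (η u) (η v) ↔ ClassPre Q u v := by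
    refine fun u v => ⟨?_, fun h => ⟨u, v, rfl, rfl, h⟩⟩
    rintro ⟨u', v', hu, hv, h⟩
    exact (((hη_eq _ _).1 hu).2.trans h).trans ((hη_eq _ _).1 hv).1
  refine ⟨_, inferInstance, hN, η, le, ⟨hη, ⟨?_, ?_, ?_, ?_⟩, ?_⟩, hle⟩
  · refine hη.forall.2 fun u => (hle u u).2 fun _ _ h => h
  · refine hη.forall₃.2 fun u v w => ?_
    rw [hle, hle, hle]
    exact ClassPre.trans
  · refine hη.forall₂.2 fun u v => ?_
    rw [hle, hle, hη_eq]
    exact And.intro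
  · rintro _ _ _ _ ⟨u, v, rfl, rfl, h⟩ ⟨u', v', rfl, rfl, h'⟩
    exact ⟨u * u', v * v', map_mul _ _ _, map_mul _ _ _, h.mul hQ h'⟩
  · intro F hF
    obtain ⟨g, hg⟩ := hη.hasRightInverse
    have key : η ⁻¹' F = ⋃ n ∈ F, ⋂₀ {L ∈ Q | g n ∈ L} := by
      ext w
      simp only [Set.mem_preimage, Set.mem_iUnion, Set.mem_sInter, Set.mem_ofPred_eq, exists_prop]
      constructor
      · intro hw
        exact ⟨η w, hw, fun L hL => ((hη_eq _ _).1 (hg (η w))).1 L hL.1 hL.2⟩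
      · rintro ⟨n, hn, h⟩
        refine hF n hn _ ?_
        rw [← hg n, hle]
        exact fun L hL hgL => h L ⟨hL, hgL⟩
    rw [key]
    exact hC.biUnion_mem F.toFinite _ fun n _ =>
      hC.sInter_mem (hfin.subset (Set.sep_subset _ _)) ((Set.sep_subset _ _).trans hQC)

/-- characterization of `C`-pairs via ordered `C`-morphisms. -/
theorem cpair_ordered_cmorphism_characterization {A : Type} [Fintype A]
    (C : LangClass A) (hC : IsPositivePrevariety C) {M : Type} [Monoid M] [Finite M]
    (α : FreeMonoid A →* M) :
    (∀ (N : Type) (_ : Monoid N) (_ : Finite N) (η : FreeMonoid A →* N)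
        (le : N → N → Prop), IsOrderedCMorphism C η le →
        ∀ s t : M, CPair C α s t →
          ∃ u v : FreeMonoid A, le (η u) (η v) ∧ α u = s ∧ α v = t) ∧
      (∃ (N : Type) (_ : Monoid N) (_ : Finite N) (η : FreeMonoid A →* N)
        (le : N → N → Prop), IsOrderedCMorphism C η le ∧
        ∀ u v : FreeMonoid A, le (η u) (η v) → CPair C α (α u) (α v)) := by
  constructor
  · rintro N _ _ η le ⟨-, ⟨hrefl, htrans, -, -⟩, hup⟩ s t hst
    by_contra hcon
    refine hst ⟨η ⁻¹' {n | ∃ u, α u = s ∧ le (η u) n}, hup _ ?_, ?_, ?_⟩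
    · rintro n ⟨u, hu, hn⟩ m hm
      exact ⟨u, hu, htrans _ _ _ hn hm⟩
    · exact fun u hu => ⟨u, hu, hrefl _⟩
    · rw [Set.eq_empty_iff_forall_notMem]
      rintro v ⟨⟨u, hu, huv⟩, hv⟩
      exact hcon ⟨u, v, huv, hu, hv⟩
  · obtain ⟨hlat, hquot, hreg⟩ := hC
    have hsep : ∀ p : M × M, ∃ K ∈ C,
        ¬ CPair C α p.1 p.2 → Separates K (α ⁻¹' {p.1}) (α ⁻¹' {p.2}) := by
      intro p
      by_cases hp : CPair C α p.1 p.2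
      · exact ⟨∅, hlat.1, fun h => absurd hp h⟩
      · obtain ⟨K, hK, hs⟩ := not_not.1 hp
        exact ⟨K, hK, fun _ => hs⟩
    choose K hKC hK using hsep
    obtain ⟨N, i₁, i₂, η, le, hη, hle⟩ :=
      exists_isOrderedCMorphism_of_finite (Q := ⋃ p, twoSidedQuotients (K p)) hlat
        (Set.iUnion_subset fun p => twoSidedQuotients_subset hquot (hKC p))
        (Set.finite_iUnion fun p => (hreg _ (hKC p)).finite_twoSidedQuotients)
        (by
          intro L hL u
          obtain ⟨p, hp⟩ := Set.mem_iUnion.1 hL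
          have h := quotientClosed_twoSidedQuotients (K p) L hp u
          exact ⟨Set.mem_iUnion.2 ⟨p, h.1⟩, Set.mem_iUnion.2 ⟨p, h.2⟩⟩)
    refine ⟨N, i₁, i₂, η, le, hη, fun u v huv => ?_⟩
    by_contra hp
    obtain ⟨hsub, hdisj⟩ := hK (α u, α v) hp
    have hv : v ∈ K (α u, α v) := (hle u v).1 huv _
      (Set.mem_iUnion.2 ⟨_, self_mem_twoSidedQuotients _⟩) (hsub rfl)
    exact Set.eq_empty_iff_forall_notMem.1 hdisj v ⟨hv, rfl⟩

end RegLang
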